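/- arXiv:math/0201035 — 2 statements merged into one kernel-verified Lean document; each statement's English description precedes it below -/
import Mathlib

section
/- Fix c, c' ∈ ℂ with c² = 18 − 6I√3 and c'² = 18 + 6I√3. Define the homogeneous polynomials in ℂ[X,Y,Z]: F₂ₐ = Y² + (1/2)Z² − (1/2)X² + (1/2)I√3·X² − (1/2)I√3·Z², F₃ₐ = (c/4)·(Z³ − XZ² + I√3·Y²Z − X²Z + X³ + XY²), F₂ᵦ = Y² + (1/2)Z² − (1/2)X² − (1/2)I√3·X² + (1/2)I√3·Z², F₃ᵦ = (c'/4)·(Z³ − XZ² − I√3·Y²Z − X²Z + X³ + XY²). Then there exist no invertible 3×3 complex matrix M and no t ∈ ℂ with t ≠ 0 such that F₂ₐ(M·v) = t²·F₂ᵦ(v) and F₃ₐ(M·v) = t³·F₃ᵦ(v) hold as polynomial identities in v = (X,Y,Z). (That is, the two torus-decomposed sextics f_a and f_b of configuration nt67 are not in the same PGL(3,ℂ)-orbit of the distinguished configuration moduli space.) -/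
open MvPolynomial

noncomputable section

/-- `I√3 ∈ ℂ`. -/
def is3 : ℂ := Complex.I * (Real.sqrt 3 : ℂ)

/-- The homogenized conic `F₂ₐ` of the representative `f_a` of configuration nt67. -/
def F2a : MvPolynomial (Fin 3) ℂ :=
  X 1 ^ 2 + C ((1 : ℂ) / 2) * X 2 ^ 2 - C ((1 : ℂ) / 2) * X 0 ^ 2
    + C (is3 / 2) * X 0 ^ 2 - C (is3 / 2) * X 2 ^ 2

/-- The homogenized cubic `F₃ₐ` of the representative `f_a` of configuration nt67. -/
def F3a (c : ℂ) : MvPolynomial (Fin 3) ℂ :=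
  C (c / 4) * (X 2 ^ 3 - X 0 * X 2 ^ 2 + C is3 * (X 1 ^ 2 * X 2)
    - X 0 ^ 2 * X 2 + X 0 ^ 3 + X 0 * X 1 ^ 2)

/-- The homogenized conic `F₂ᵦ` of the representative `f_b` of configuration nt67. -/
def F2b : MvPolynomial (Fin 3) ℂ :=
  X 1 ^ 2 + C ((1 : ℂ) / 2) * X 2 ^ 2 - C ((1 : ℂ) / 2) * X 0 ^ 2
    - C (is3 / 2) * X 0 ^ 2 + C (is3 / 2) * X 2 ^ 2

/-- The homogenized cubic `F₃ᵦ` of the representative `f_b` of configuration nt67. -/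
def F3b (c' : ℂ) : MvPolynomial (Fin 3) ℂ :=
  C (c' / 4) * (X 2 ^ 3 - X 0 * X 2 ^ 2 - C is3 * (X 1 ^ 2 * X 2)
    - X 0 ^ 2 * X 2 + X 0 ^ 3 + X 0 * X 1 ^ 2)

/-- The pullback `F(M·v)` of a polynomial `F ∈ ℂ[X,Y,Z]` along the linear substitution
given by a `3×3` matrix `M`. -/
def pullback (M : Matrix (Fin 3) (Fin 3) ℂ) (F : MvPolynomial (Fin 3) ℂ) :
    MvPolynomial (Fin 3) ℂ :=
  aeval (fun i => ∑ j, C (M i j) * X j) F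

/-- The conic `y² + ωpq` in the coordinates `p = X - Z`, `q = X + Z`, `y = Y`. -/
def conicForm (ω p q y : ℂ) : ℂ := y ^ 2 + ω * (p * q)

/-- The nodal cubic `p²q - y²(ωp + ω²q)` in the coordinates `p = X - Z`, `q = X + Z`, `y = Y`. -/
def cubicForm (ω p q y : ℂ) : ℂ := p ^ 2 * q - y ^ 2 * (ω * p + ω ^ 2 * q)

/-- The only singular point of the nodal cubic is `p = y = 0`. -/
lemma eq_zero_of_cubicForm_grad_eq_zero {ω p q y : ℂ} (hω : ω ≠ 0)
    (hp : 2 * p * q - ω * y ^ 2 = 0) (hq : p ^ 2 - ω ^ 2 * y ^ 2 = 0)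
    (hy : y * (p + ω * q) = 0) : p = 0 ∧ y = 0 := by
  have hy0 : y = 0 := by
    have h : 3 * ω ^ 2 * y ^ 3 = 0 := by
      linear_combination (-ω * y) * hp - 2 * y * hq + 2 * p * hy
    simpa [hω] using h
  subst hy0
  exact ⟨by simpa using hq, rfl⟩

/-- If `ω² + ω + 1 = 0`, no invertible linear substitution takes the conic and the nodal cubic
of parameter `ω` to multiples of those of parameter `ω²`, scaled by `t²` and by `t³`
respectively. -/
lemma not_equivalent_of_forms {ω k k' t : ℂ} (hω : ω ^ 2 + ω + 1 = 0) (hk : k ≠ 0)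
    (hk' : k' ≠ 0) (ht : t ≠ 0) (N : Matrix (Fin 3) (Fin 3) ℂ) (hN : N.det ≠ 0)
    (h2 : ∀ p q y, conicForm ω (N 0 0 * p + N 0 1 * q + N 0 2 * y)
      (N 1 0 * p + N 1 1 * q + N 1 2 * y) (N 2 0 * p + N 2 1 * q + N 2 2 * y)
        = t ^ 2 * conicForm (ω ^ 2) p q y)
    (h3 : ∀ p q y, k * cubicForm ω (N 0 0 * p + N 0 1 * q + N 0 2 * y)
      (N 1 0 * p + N 1 1 * q + N 1 2 * y) (N 2 0 * p + N 2 1 * q + N 2 2 * y)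
        = t ^ 3 * (k' * cubicForm (ω ^ 2) p q y)) : False := by
  have hω0 : ω ≠ 0 := by rintro rfl; simp at hω
  simp only [conicForm, cubicForm] at h2 h3
  have hgrad : ![2 * N 0 1 * N 1 1 - ω * N 2 1 ^ 2, N 0 1 ^ 2 - ω ^ 2 * N 2 1 ^ 2,
      -2 * N 2 1 * (ω * N 0 1 + ω ^ 2 * N 1 1)] = 0 := by
    refine Matrix.eq_zero_of_vecMul_eq_zero hN (funext fun j => mul_left_cancel₀ hk ?_)
    fin_cases j <;>
      simp only [Fin.zero_eta, Fin.mk_one, Fin.reduceFinMk, Matrix.vecMul, dotProduct,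
        Fin.sum_univ_three, Matrix.cons_val, Pi.zero_apply]
    · linear_combination (h3 1 1 0 - h3 (-1) 1 0) / 2 - h3 1 0 0
    · linear_combination 3 * h3 0 1 0
    · linear_combination (h3 0 1 1 - h3 0 1 (-1)) / 2 - h3 0 0 1
  have g0 := congrFun hgrad 0
  have g1 := congrFun hgrad 1
  have g2 := congrFun hgrad 2
  simp only [Matrix.cons_val, Pi.zero_apply] at g0 g1 g2
  obtain ⟨h01, h21⟩ := eq_zero_of_cubicForm_grad_eq_zero hω0 g0 g1
    (mul_left_cancel₀ (mul_ne_zero two_ne_zero hω0) (by linear_combination -g2))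
  have h11 : N 1 1 ≠ 0 := by
    intro h; apply hN; simp [Matrix.det_fin_three, h, h01, h21]
  have h02 : N 0 2 = 0 := by
    have : ω * N 0 2 * N 1 1 = 0 := by
      linear_combination (h2 0 1 1 - h2 0 1 (-1)) / 2 - ω * N 1 2 * h01 - 2 * N 2 2 * h21
    simpa [hω0, h11] using this
  simp only [h01, h02, h21, zero_mul, add_zero] at h2 h3
  have hpq : N 0 0 * N 1 1 = t ^ 2 * ω :=
    mul_left_cancel₀ hω0 (by linear_combination (h2 1 1 0 - h2 (-1) 1 0) / 2)
  have hyy : N 2 2 ^ 2 = t ^ 2 := by linear_combination h2 0 0 1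
  have h00 : N 0 0 ≠ 0 := by rintro h; simp [h, ht, hω0] at hpq
  have h22 : N 2 2 ≠ 0 := by
    intro h
    simp [h, eq_comm (a := (0 : ℂ)), ht] at hyy
  have h20 : N 2 0 = 0 := by
    have : k * (ω ^ 2 * (N 1 1 * (N 2 0 * N 2 2))) = 0 := by
      linear_combination
        (h3 1 1 1 - h3 (-1) 1 1 - h3 1 1 (-1) + h3 (-1) 1 (-1)) * (-1 / 8)
    simpa [hk, hω0, h11, h22] using this
  simp only [h20, zero_mul, zero_add] at h2 h3
  have h10 : N 1 0 = 0 := by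
    have : ω * (N 0 0 * N 1 0) = 0 := by linear_combination h2 1 0 0
    simpa [hω0, h00] using this
  simp only [h10, zero_mul, zero_add] at h3
  have hppq : k * N 0 0 ^ 2 * N 1 1 = t ^ 3 * k' := by
    linear_combination (h3 1 1 0 + h3 (-1) 1 0) / 2 - h3 0 1 0
  have hpyy : k * N 0 0 * N 2 2 ^ 2 = t ^ 3 * k' * ω :=
    mul_left_cancel₀ hω0
      (by linear_combination (h3 1 0 1 + h3 1 0 (-1)) * (-1 / 2) + h3 1 0 0)
  have hkey : t ^ 3 * k' * (ω ^ 2 - 1) = 0 := by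
    linear_combination hppq - k * N 0 0 * hpq - ω * hpyy + ω * k * N 0 0 * hyy
  have h1 : ω ^ 2 - 1 = 0 := by simpa [ht, hk'] using hkey
  have : (3 : ℂ) = 0 := by linear_combination (2 - ω) * hω + (ω - 1) * h1
  norm_num at this

lemma is3_sq : is3 ^ 2 = -3 := by
  rw [is3, mul_pow, Complex.I_sq, ← Complex.ofReal_pow, Real.sq_sqrt (by norm_num)]
  norm_num

/-- The two torus-decomposed sextics `f_a` and `f_b` of configuration
`nt67 = [[2A₂,A₅,E₆],[2A₂]]` are not in the same `PGL(3,ℂ)`-orbit of the distinguished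
configuration moduli space: no invertible matrix `M` and no `t ≠ 0` satisfy
`F₂ₐ(M·v) = t²·F₂ᵦ(v)` and `F₃ₐ(M·v) = t³·F₃ᵦ(v)`. -/
theorem nt67_not_PGL_equivalent (c c' : ℂ)
    (hc : c ^ 2 = 18 - 6 * is3) (hc' : c' ^ 2 = 18 + 6 * is3) :
    ¬ ∃ (M : Matrix (Fin 3) (Fin 3) ℂ) (t : ℂ), IsUnit M.det ∧ t ≠ 0 ∧
        pullback M F2a = C (t ^ 2) * F2b ∧
        pullback M (F3a c) = C (t ^ 3) * F3b c' := by
  rintro ⟨M, t, hM, ht, h2, h3⟩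
  have hs := is3_sq
  have hc0 : c ≠ 0 := by
    rintro rfl
    have : (12 : ℂ) = 0 := by linear_combination hs - (is3 + 3) / 6 * hc
    norm_num at this
  have hc0' : c' ≠ 0 := by
    rintro rfl
    have : (12 : ℂ) = 0 := by linear_combination hs - (3 - is3) / 6 * hc'
    norm_num at this
  refine not_equivalent_of_forms (ω := (-1 + is3) / 2) (k := c / 4) (k' := c' / 4) (t := t)
    (by linear_combination hs / 4) (by simpa using hc0) (by simpa using hc0') ht
    (!![1, 0, -1; 1, 0, 1; 0, 1, 0] * M * !![1/2, 1/2, 0; 0, 0, 1; -1/2, 1/2, 0]) ?_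
    (fun p q y => ?_) (fun p q y => ?_)
  · rw [Matrix.det_mul, Matrix.det_mul]
    refine mul_ne_zero (mul_ne_zero ?_ hM.ne_zero) ?_
    · simp [Matrix.det_fin_three]
    · simp [Matrix.det_fin_three]
      norm_num
  · have h := congrArg (eval ![(p + q) / 2, y, (q - p) / 2]) h2
    simp [pullback, F2a, F2b, Fin.sum_univ_three] at h
    simp [conicForm, Matrix.mul_apply, Matrix.vecMul, dotProduct, Fin.sum_univ_three]
    linear_combination h - t ^ 2 * p * q / 4 * hs
  · have h := congrArg (eval ![(p + q) / 2, y, (q - p) / 2]) h3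
    simp [pullback, F3a, F3b, Fin.sum_univ_three] at h
    simp [cubicForm, Matrix.mul_apply, Matrix.vecMul, dotProduct, Fin.sum_univ_three]
    linear_combination h
      - c / 16 * (M 1 0 * ((p + q) / 2) + M 1 1 * y + M 1 2 * ((q - p) / 2)) ^ 2
          * ((M 0 0 + M 2 0) * ((p + q) / 2) + (M 0 1 + M 2 1) * y
            + (M 0 2 + M 2 2) * ((q - p) / 2)) * hs
      + t ^ 3 * c' / 16 * y ^ 2
          * (p + (((-1 + is3) / 2) ^ 2 + (-1 - is3) / 2 + 1) * q) * hs

end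
end

section
/- Fix c' ∈ ℂ with c'² = 18 + 6I√3 and c ∈ ℂ with c² = 18 − 6I√3. Define the homogeneous polynomials in ℂ[X,Y,Z]: H₂ = Y² − Z² + X², H₃ = (c/4)·(X³ − X²Z − I√3·XY² − XZ² + Z³ − Y²Z), F₂ᵦ = Y² + (1/2)Z² − (1/2)X² − (1/2)I√3·X² + (1/2)I√3·Z², F₃ᵦ = (c'/4)·(Z³ − XZ² − I√3·Y²Z − X²Z + X³ + XY²). Then there exist an invertible 3×3 complex matrix B and t ∈ ℂ with t ≠ 0 such that H₂(B·v) = t²·F₂ᵦ(v) and H₃(B·v) = t³·F₃ᵦ(v) hold as polynomial identities in v = (X,Y,Z). (That is, the second torus decomposition (h₂, h₃) of the sextic f_a of configuration nt67 and the decomposition (f₂ᵦ, f₃ᵦ) of f_b lie in the same GL(3,ℂ)-orbit; a suitable matrix is B = [[3/4, 0, −(1/4)I√3], [0, (1/4)√3 + (3/4)I, 0], [−(1/4)I√3, 0, 3/4]].) -/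
open MvPolynomial

noncomputable section

/-- The homogenized conic `H₂` of the second torus decomposition of the sextic `f_a`
of configuration nt67. -/
def H2 : MvPolynomial (Fin 3) ℂ := X 1 ^ 2 - X 2 ^ 2 + X 0 ^ 2

/-- The homogenized cubic `H₃` of the second torus decomposition of the sextic `f_a`
of configuration nt67. -/
def H3 (c : ℂ) : MvPolynomial (Fin 3) ℂ :=
  C (c / 4) * (X 0 ^ 3 - X 0 ^ 2 * X 2 - C is3 * (X 0 * X 1 ^ 2)
    - X 0 * X 2 ^ 2 + X 2 ^ 3 - X 1 ^ 2 * X 2)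

/-- The second torus decomposition `(H₂, H₃)` of the sextic `f_a` of
configuration `nt67 = [[2A₂,A₅,E₆],[2A₂]]` and the decomposition `(F₂ᵦ, F₃ᵦ)` of `f_b`
lie in the same `GL(3,ℂ)`-orbit: there are an invertible matrix `B` and `t ≠ 0` with
`H₂(B·v) = t²·F₂ᵦ(v)` and `H₃(B·v) = t³·F₃ᵦ(v)`. -/
theorem nt67_second_decomposition_GL_equivalent (c c' : ℂ)
    (hc : c ^ 2 = 18 - 6 * is3) (hc' : c' ^ 2 = 18 + 6 * is3) :
    ∃ (B : Matrix (Fin 3) (Fin 3) ℂ) (t : ℂ), IsUnit B.det ∧ t ≠ 0 ∧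
      pullback B H2 = C (t ^ 2) * F2b ∧
      pullback B (H3 c) = C (t ^ 3) * F3b c' := by
  have hs := is3_sq
  have hprod : c ^ 2 * c' ^ 2 = 432 := by
    rw [hc, hc']
    linear_combination -36 * hs
  have hc0 : c ≠ 0 := by
    rintro rfl
    norm_num at hprod
  have hc0' : c' ≠ 0 := by
    rintro rfl
    norm_num at hprod
  have hs0 : is3 ≠ 0 := by
    intro h
    norm_num [h] at hs
  obtain ⟨t, ht⟩ : ∃ t : ℂ, t = -is3 * c / (2 * c') := ⟨_, rfl⟩
  have ht0 : t ≠ 0 := by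
    rw [ht]
    exact div_ne_zero (mul_ne_zero (neg_ne_zero.mpr hs0) hc0)
      (mul_ne_zero two_ne_zero hc0')
  have htc : t * c' = -is3 * c / 2 := by
    rw [ht]
    field_simp
  have ht2 : t ^ 2 = 3 * (is3 - 1) / 8 := by
    apply mul_right_cancel₀ (pow_ne_zero 2 hc0')
    linear_combination (t * c' - is3 * c / 2) * htc + is3 ^ 2 / 4 * hc
      - 3 * (is3 - 1) / 8 * hc' + (9 / 4 - 3 / 2 * is3) * hs
  have ht3 : t ^ 3 * c' = 3 * (is3 + 3) / 16 * c := by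
    linear_combination t * c' * ht2 + 3 * (is3 - 1) / 8 * htc - 3 / 16 * c * hs
  refine ⟨!![3 / 4, 0, -is3 / 4; 0, t, 0; -is3 / 4, 0, 3 / 4], t, ?_, ht0, ?_, ?_⟩
  · have hdet : (!![3 / 4, 0, -is3 / 4; 0, t, 0; -is3 / 4, 0, 3 / 4] :
        Matrix (Fin 3) (Fin 3) ℂ).det = 3 / 4 * t := by
      simp [Matrix.det_fin_three]
      linear_combination -t / 16 * hs
    rw [hdet, isUnit_iff_ne_zero]
    exact mul_ne_zero (by norm_num) ht0
  · refine MvPolynomial.funext fun v => ?_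
    simp [pullback, H2, F2b, Fin.sum_univ_three]
    linear_combination (v 0 ^ 2 - v 2 ^ 2) * ((1 + is3) / 2 * ht2 + 1 / 8 * hs)
  · refine MvPolynomial.funext fun v => ?_
    simp [pullback, H3, F3b, Fin.sum_univ_three]
    linear_combination
      -((v 2 - v 0) ^ 2 * (v 0 + v 2) + v 1 ^ 2 * (v 0 - is3 * v 2)) / 4 * ht3
      - c * v 1 ^ 2 * (2 * is3 * v 0 + (3 - is3 ^ 2) * v 2) / 16 * ht2
      - c * ((3 + is3) / 256 * (v 2 - v 0) ^ 2 * (v 0 + v 2)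
        + 3 / 128 * v 1 ^ 2 * (2 * v 0 - (is3 + 1) * v 2)) * hs

end
end
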